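/- Let r ≥ 1 and 1 ≤ b1 < b2 − 1 be integers. Then the algebraic connectivity strictly decreases when balancing the crab graph: λ2(CG_{b1+1, b2−1; r}) < λ2(CG_{b1, b2; r}). Consequently, for integers 1 ≤ b1 < b, one has λ2(CG_{b1, b−b1; r}) ≤ λ2(CG_{1, b−1; r}) with equality if and only if b1 = 1 or b1 = b−1. -/

import Mathlib

open scoped Classical

noncomputable section

/-- The `k`-th smallest root (1-based, with multiplicity) of the characteristic polynomial
of a real matrix.  For a symmetric matrix these are exactly its eigenvalues listed
in nondecreasing order. -/
def kthEig {ι : Type*} [Fintype ι] [DecidableEq ι] (M : Matrix ι ι ℝ) (k : ℕ) : ℝ :=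
  (M.charpoly.roots.sort (· ≤ ·)).getD (k - 1) 0

/-- The `k`-th smallest Laplacian eigenvalue (1-based); `lapEig G 2` is the algebraic
connectivity. -/
def lapEig {V : Type*} [Fintype V] (G : SimpleGraph V) (k : ℕ) : ℝ :=
  kthEig (SimpleGraph.lapMatrix ℝ G) k

/-- The Steklov (Dirichlet-to-Neumann) matrix of a graph with boundary `B`:
the Schur complement of the interior block of the Laplacian, i.e. the matrix of the map
sending `f : B → ℝ` to the normal derivative of its harmonic extension. -/
def steklovMatrix {V : Type*} [Fintype V] (G : SimpleGraph V) (B : Set V) :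
    Matrix B B ℝ :=
  let L := SimpleGraph.lapMatrix ℝ G
  L.submatrix (Subtype.val : B → V) (Subtype.val : B → V) -
    L.submatrix (Subtype.val : B → V) (Subtype.val : (Bᶜ : Set V) → V) *
      (L.submatrix (Subtype.val : (Bᶜ : Set V) → V) (Subtype.val : (Bᶜ : Set V) → V))⁻¹ *
      L.submatrix (Subtype.val : (Bᶜ : Set V) → V) (Subtype.val : B → V)

/-- The `k`-th smallest Steklov eigenvalue (1-based). -/
def steklovEig {V : Type*} [Fintype V] (G : SimpleGraph V) (B : Set V) (k : ℕ) : ℝ :=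
  kthEig (steklovMatrix G B) k

/-- The set of leaves (vertices of degree 1) of a graph. -/
def leaves {V : Type*} (G : SimpleGraph V) : Set V := {v | (G.neighborSet v).ncard = 1}

/-- A set of edges is a matching if the edges belong to the graph and are pairwise
vertex-disjoint. -/
def IsMatchingSet {V : Type*} (G : SimpleGraph V) (s : Set (Sym2 V)) : Prop :=
  s ⊆ G.edgeSet ∧ s.Pairwise fun e f => ∀ v, v ∈ e → v ∉ f

/-- The matching number of a graph: the maximum size of a matching. -/
def matchingNumber {V : Type*} [Fintype V] (G : SimpleGraph V) : ℕ :=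
  sSup {n | ∃ s : Set (Sym2 V), IsMatchingSet G s ∧ s.ncard = n}

/-- The star graph on `n` vertices. -/
def starGraph (n : ℕ) : SimpleGraph (Fin n) :=
  SimpleGraph.fromRel (fun i _ => i.val = 0)

/-- Vertices of the spider graph with two leg lengths. -/
abbrev Spider2V (p₁ p₂ ℓ₁ ℓ₂ : ℕ) := Option ((Fin p₁ × Fin ℓ₁) ⊕ (Fin p₂ × Fin ℓ₂))

def spider2Rel (p₁ p₂ ℓ₁ ℓ₂ : ℕ) :
    Spider2V p₁ p₂ ℓ₁ ℓ₂ → Spider2V p₁ p₂ ℓ₁ ℓ₂ → Prop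
  | none, some (Sum.inl (_, j)) => j.val = 0
  | none, some (Sum.inr (_, j)) => j.val = 0
  | some (Sum.inl (i, j)), some (Sum.inl (i', j')) => i = i' ∧ j'.val = j.val + 1
  | some (Sum.inr (i, j)), some (Sum.inr (i', j')) => i = i' ∧ j'.val = j.val + 1
  | _, _ => False

/-- The spider graph `Sp_{p₁,p₂;ℓ₁,ℓ₂}`: `p₁` paths of length `ℓ₁` and `p₂` paths of
length `ℓ₂`, with one endpoint of each path identified to a common center (`none`). -/
def spider2 (p₁ p₂ ℓ₁ ℓ₂ : ℕ) : SimpleGraph (Spider2V p₁ p₂ ℓ₁ ℓ₂) :=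
  SimpleGraph.fromRel (spider2Rel p₁ p₂ ℓ₁ ℓ₂)

/-- Vertices of the crab graph. -/
abbrev CrabV (b₁ b₂ r : ℕ) := Option (Fin b₁ × Fin r) ⊕ Option (Fin b₂ × Fin r)

def crabRel (b₁ b₂ r : ℕ) : CrabV b₁ b₂ r → CrabV b₁ b₂ r → Prop
  | Sum.inl none, Sum.inr none => True
  | Sum.inl none, Sum.inl (some (_, j)) => j.val = 0
  | Sum.inl (some (i, j)), Sum.inl (some (i', j')) => i = i' ∧ j'.val = j.val + 1
  | Sum.inr none, Sum.inr (some (_, j)) => j.val = 0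
  | Sum.inr (some (i, j)), Sum.inr (some (i', j')) => i = i' ∧ j'.val = j.val + 1
  | _, _ => False

/-- The crab graph `CG_{b₁,b₂;r}`: two spiders `Sp_{b₁;r}` and `Sp_{b₂;r}` with their
centers joined by an edge. -/
def crab (b₁ b₂ r : ℕ) : SimpleGraph (CrabV b₁ b₂ r) :=
  SimpleGraph.fromRel (crabRel b₁ b₂ r)


open Matrix in
theorem lapEig_two_spec {V : Type*} [Fintype V] [hd : DecidableEq V] (G : SimpleGraph V)
    [hR : DecidableRel G.Adj] (hV : 2 ≤ Fintype.card V) :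
    ∃ (e₀ e₁ : V → ℝ) (μ : ℝ), e₀ ⬝ᵥ e₀ = 1 ∧ e₁ ⬝ᵥ e₁ = 1 ∧ e₀ ⬝ᵥ e₁ = 0 ∧
      G.lapMatrix ℝ *ᵥ e₀ = μ • e₀ ∧ G.lapMatrix ℝ *ᵥ e₁ = lapEig G 2 • e₁ ∧
      0 ≤ μ ∧ μ ≤ lapEig G 2 ∧
      ∀ g, g ⬝ᵥ e₀ = 0 → lapEig G 2 * (g ⬝ᵥ g) ≤ g ⬝ᵥ G.lapMatrix ℝ *ᵥ g := by
  obtain rfl : hd = fun a b => Classical.propDecidable _ := Subsingleton.elim _ _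
  obtain rfl : hR = fun a b => Classical.propDecidable _ := Subsingleton.elim _ _
  have hpsd : (G.lapMatrix ℝ).PosSemidef := G.posSemidef_lapMatrix ℝ
  have hA := hpsd.isHermitian
  have hroots := hA.roots_charpoly_eq_eigenvalues
  have hsorted := (G.lapMatrix ℝ).charpoly.roots.pairwise_sort (· ≤ ·)
  have hcoe := (G.lapMatrix ℝ).charpoly.roots.sort_eq (· ≤ ·)
  have hlen : ((G.lapMatrix ℝ).charpoly.roots.sort (· ≤ ·)).length = Fintype.card V := by
    rw [Multiset.length_sort, hroots]; simp
  unfold lapEig kthEig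
  generalize (G.lapMatrix ℝ).charpoly.roots.sort (· ≤ ·) = l at *
  match l, hlen with
  | [], h => simp at h; omega
  | [_], h => simp at h; omega
  | a :: b :: t, _ =>
    simp only [Nat.add_one_sub_one, List.getD_cons_succ, List.getD_cons_zero]
    rw [← hcoe] at hroots
    have hmap : Multiset.map hA.eigenvalues Finset.univ.val = a ::ₘ b ::ₘ (t : Multiset ℝ) :=
      hroots.symm
    obtain ⟨i₀, -, h₀⟩ := Multiset.mem_map.1
      (hmap ▸ Multiset.mem_cons_self a _ : a ∈ Multiset.map hA.eigenvalues Finset.univ.val)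
    have hmap' : Multiset.map hA.eigenvalues (Finset.univ.erase i₀).val =
        b ::ₘ (t : Multiset ℝ) := by
      rw [← Multiset.cons_inj_right a, ← hmap, ← h₀, ← Multiset.map_cons, Finset.erase_val,
        Multiset.cons_erase (Finset.mem_univ i₀)]
    obtain ⟨i₁, hi₁, h₁⟩ := Multiset.mem_map.1
      (hmap' ▸ Multiset.mem_cons_self b _ :
        b ∈ Multiset.map hA.eigenvalues (Finset.univ.erase i₀).val)
    have hne : i₁ ≠ i₀ := (Finset.mem_erase.1 hi₁).1
    have hle : ∀ i, i ≠ i₀ → b ≤ hA.eigenvalues i := by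
      intro i hi
      have hmem : hA.eigenvalues i ∈ b ::ₘ (t : Multiset ℝ) :=
        hmap' ▸ Multiset.mem_map_of_mem _ (Finset.mem_erase.2 ⟨hi, Finset.mem_univ i⟩)
      rcases Multiset.mem_cons.1 hmem with h | h
      · exact h.ge
      · exact (List.pairwise_cons.1 (List.pairwise_cons.1 hsorted).2).1 _ (by simpa using h)
    have hab : a ≤ b := (List.pairwise_cons.1 hsorted).1 b (by simp)
    set B := hA.eigenvectorBasis with hB
    have horth : ∀ i j, (B i).ofLp ⬝ᵥ (B j).ofLp = if i = j then 1 else 0 := by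
      intro i j
      have := orthonormal_iff_ite.1 B.orthonormal j i
      rw [EuclideanSpace.inner_eq_star_dotProduct, star_trivial] at this
      rw [this]
      simp [eq_comm]
    have hvec := fun i => hA.mulVec_eigenvectorBasis i
    refine ⟨B i₀, B i₁, a, by simp [horth], by simp [horth], by simp [horth, hne.symm],
      by rw [hvec, h₀], by rw [hvec, h₁], h₀ ▸ hpsd.eigenvalues_nonneg i₀, hab, ?_⟩
    intro g hg
    have hexp : ∀ x y : V → ℝ, x ⬝ᵥ y = ∑ i, (x ⬝ᵥ (B i).ofLp) * (y ⬝ᵥ (B i).ofLp) := by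
      intro x y
      have := B.sum_inner_mul_inner (WithLp.toLp 2 y) (WithLp.toLp 2 x)
      simp only [EuclideanSpace.inner_eq_star_dotProduct, star_trivial] at this
      rw [← this]
      refine Finset.sum_congr rfl fun i _ => ?_
      rw [mul_comm, dotProduct_comm y]
    have hL : ∀ i, (G.lapMatrix ℝ *ᵥ g) ⬝ᵥ (B i).ofLp =
        hA.eigenvalues i * (g ⬝ᵥ (B i).ofLp) := by
      intro i
      rw [dotProduct_comm, dotProduct_mulVec, ← mulVec_transpose,
        (G.isSymm_lapMatrix (R := ℝ)).eq, hvec, smul_dotProduct, dotProduct_comm, smul_eq_mul]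
    rw [hexp g g, hexp g (_ *ᵥ g), Finset.mul_sum]
    refine Finset.sum_le_sum fun i _ => ?_
    rw [hL]
    by_cases hi : i = i₀
    · simp [hi, hg]
    · nlinarith [hle i hi, mul_nonneg (sub_nonneg.2 (hle i hi)) (mul_self_nonneg (g ⬝ᵥ (B i).ofLp))]

theorem dotProduct_lapMatrix_fromRel {V : Type*} [Fintype V] [DecidableEq V] (rel : V → V → Prop)
    [DecidableRel rel] (h : ∀ x y, rel x y → ¬ rel y x) {G : SimpleGraph V}
    [DecidableRel G.Adj] (hG : G = SimpleGraph.fromRel rel) (f g : V → ℝ) :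
    g ⬝ᵥ Matrix.mulVec (G.lapMatrix ℝ) f =
      ∑ x, ∑ y, if rel x y then (g x - g y) * (f x - f y) else 0 := by
  subst hG
  have key : ∀ x, Matrix.mulVec ((SimpleGraph.fromRel rel).lapMatrix ℝ) f x =
      (∑ y, if rel x y then f x - f y else 0) + ∑ y, if rel y x then f x - f y else 0 := by
    intro x
    rw [SimpleGraph.lapMatrix_mulVec_apply, ← SimpleGraph.card_neighborFinset_eq_degree,
      ← nsmul_eq_mul, ← Finset.sum_const, ← Finset.sum_sub_distrib,
      SimpleGraph.neighborFinset_eq_filter, Finset.sum_filter, ← Finset.sum_add_distrib]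
    refine Finset.sum_congr rfl fun y _ => ?_
    have h1 := h x y
    simp only [SimpleGraph.fromRel_adj]
    by_cases hxy : x = y
    · subst hxy; simp
    · by_cases h2 : rel x y <;> by_cases h3 : rel y x <;> simp_all
  simp only [dotProduct, key, mul_add, Finset.sum_add_distrib, Finset.mul_sum, mul_ite, mul_zero]
  conv_lhs => enter [2]; rw [Finset.sum_comm]
  simp only [← Finset.sum_add_distrib]
  refine Finset.sum_congr rfl fun x _ => Finset.sum_congr rfl fun y _ => ?_
  split_ifs <;> ring

theorem lapEig_eq_of_iso {V W : Type*} [Fintype V] [Fintype W] {G : SimpleGraph V}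
    {H : SimpleGraph W} (e : G ≃g H) (k : ℕ) : lapEig G k = lapEig H k := by
  have : H.lapMatrix ℝ = Matrix.reindex e.toEquiv e.toEquiv (G.lapMatrix ℝ) := by
    ext x y
    obtain ⟨x, rfl⟩ := e.surjective x
    obtain ⟨y, rfl⟩ := e.surjective y
    have h1 : e.toEquiv.symm (e x) = x := e.toEquiv.symm_apply_apply x
    have h2 : e.toEquiv.symm (e y) = y := e.toEquiv.symm_apply_apply y
    simp [SimpleGraph.lapMatrix, SimpleGraph.degMatrix, Matrix.diagonal_apply, h1, h2, e.map_adj_iff]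
  unfold lapEig kthEig
  rw [this, Matrix.charpoly_reindex]

theorem crab_lapEig_comm (b₁ b₂ r k : ℕ) : lapEig (crab b₁ b₂ r) k = lapEig (crab b₂ b₁ r) k := by
  refine lapEig_eq_of_iso ⟨Equiv.sumComm _ _, ?_⟩ k
  rintro ((_ | ⟨_, _⟩) | (_ | ⟨_, _⟩)) ((_ | ⟨_, _⟩) | (_ | ⟨_, _⟩)) <;>
    simp [crab, SimpleGraph.fromRel_adj, crabRel]

/-- The values along a leg of length `r` attached at a vertex of value `c`, indexed by the
distance from the free end. -/
def legExt {r : ℕ} (c : ℝ) (a : Fin r → ℝ) (k : ℕ) : ℝ :=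
  if h : k < r then a (Fin.rev ⟨k, h⟩) else c

theorem legExt_self {r : ℕ} (c : ℝ) (a : Fin r → ℝ) : legExt c a r = c := by
  simp [legExt]

theorem sum_legExt {r : ℕ} (c c' : ℝ) (a a' : Fin r → ℝ) :
    ∑ j, a j * a' j = ∑ k ∈ Finset.range r, legExt c a k * legExt c' a' k := by
  rw [Finset.sum_range, ← Equiv.sum_comp Fin.revPerm]
  simp [legExt]

theorem legExt_energy {r : ℕ} (c c' : ℝ) (a a' : Fin r → ℝ) :
    (∑ j : Fin r, if j.val = 0 then (c - a j) * (c' - a' j) else 0) +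
      (∑ j : Fin r, ∑ j' : Fin r,
        if j'.val = j.val + 1 then (a j - a j') * (a' j - a' j') else 0) =
    ∑ k ∈ Finset.range r,
      (legExt c a k - legExt c a (k + 1)) * (legExt c' a' k - legExt c' a' (k + 1)) := by
  cases r with
  | zero => simp
  | succ n =>
    have hlast : ∀ (c : ℝ) (a : Fin (n + 1) → ℝ), legExt c a n = a 0 := by
      intro c a
      simp only [legExt, Nat.lt_succ_self, dite_true]
      congr 1
      ext
      simp [Fin.val_rev]
    have hfirst : (∑ j : Fin (n + 1), if j.val = 0 then (c - a j) * (c' - a' j) else 0) =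
        (c - a 0) * (c' - a' 0) := by
      rw [Fin.sum_univ_succ]; simp
    have hsecond : (∑ j : Fin (n + 1), ∑ j' : Fin (n + 1),
        if j'.val = j.val + 1 then (a j - a j') * (a' j - a' j') else 0) =
        ∑ t : Fin n, (a t.castSucc - a t.succ) * (a' t.castSucc - a' t.succ) := by
      rw [Fin.sum_univ_castSucc]
      have h0 : (∑ j' : Fin (n + 1), if j'.val = (Fin.last n).val + 1 then
          (a (Fin.last n) - a j') * (a' (Fin.last n) - a' j') else 0) = 0 := by
        refine Finset.sum_eq_zero fun j' _ => if_neg ?_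
        have := j'.isLt
        simp only [Fin.val_last]; omega
      rw [h0, add_zero]
      refine Finset.sum_congr rfl fun t _ => ?_
      rw [Fin.sum_univ_succ]
      simp [Fin.val_inj]
    rw [hfirst, hsecond, Finset.sum_range_succ, hlast, hlast, legExt_self, legExt_self,
      Finset.sum_range, ← Equiv.sum_comp Fin.revPerm, add_comm]
    congr 1
    · refine Finset.sum_congr rfl fun t _ => ?_
      have h1 : ∀ (c : ℝ) (a : Fin (n + 1) → ℝ), legExt c a t.val = a t.rev.succ := by
        intro c a
        have := t.isLt
        simp only [legExt, show t.val < n + 1 by omega, dite_true]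
        congr 1
        ext
        simp only [Fin.val_rev, Fin.val_succ]
        omega
      have h2 : ∀ (c : ℝ) (a : Fin (n + 1) → ℝ), legExt c a (t.val + 1) = a t.rev.castSucc := by
        intro c a
        have := t.isLt
        simp only [legExt, show t.val + 1 < n + 1 by omega, dite_true]
        congr 1
        ext
        simp only [Fin.val_rev, Fin.val_castSucc]
        omega
      rw [h1, h1, h2, h2, Fin.revPerm_apply]
      ring
    · ring

/-- The values of a function on a leg of a crab graph, indexed by the distance from the leaf;
from index `r` on this is the value at the center. -/
def crabLeg {b₁ b₂ r : ℕ} (f : CrabV b₁ b₂ r → ℝ) : Fin b₁ ⊕ Fin b₂ → ℕ → ℝ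
  | Sum.inl i => legExt (f (Sum.inl none)) fun j => f (Sum.inl (some (i, j)))
  | Sum.inr i => legExt (f (Sum.inr none)) fun j => f (Sum.inr (some (i, j)))

theorem crab_dotProduct {b₁ b₂ r : ℕ} (f g : CrabV b₁ b₂ r → ℝ) :
    g ⬝ᵥ f = g (Sum.inl none) * f (Sum.inl none) + g (Sum.inr none) * f (Sum.inr none) +
      ∑ s, ∑ k ∈ Finset.range r, crabLeg g s k * crabLeg f s k := by
  simp only [dotProduct, Fintype.sum_sum_type, Fintype.sum_option, Fintype.sum_prod_type,
    crabLeg, ← sum_legExt]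
  ring

theorem crabRel_asymm {b₁ b₂ r : ℕ} (x y : CrabV b₁ b₂ r) :
    crabRel b₁ b₂ r x y → ¬ crabRel b₁ b₂ r y x := by
  rcases x with ((_ | ⟨_, _⟩) | (_ | ⟨_, _⟩)) <;> rcases y with ((_ | ⟨_, _⟩) | (_ | ⟨_, _⟩)) <;>
    simp [crabRel] <;> omega

theorem crab_energy {b₁ b₂ r : ℕ} [DecidableEq (CrabV b₁ b₂ r)]
    [DecidableRel (crab b₁ b₂ r).Adj] (f g : CrabV b₁ b₂ r → ℝ) :
    g ⬝ᵥ Matrix.mulVec ((crab b₁ b₂ r).lapMatrix ℝ) f =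
      (g (Sum.inl none) - g (Sum.inr none)) * (f (Sum.inl none) - f (Sum.inr none)) +
      ∑ s, ∑ k ∈ Finset.range r,
        (crabLeg g s k - crabLeg g s (k + 1)) * (crabLeg f s k - crabLeg f s (k + 1)) := by
  rw [dotProduct_lapMatrix_fromRel (crabRel b₁ b₂ r) crabRel_asymm
    (show crab b₁ b₂ r = SimpleGraph.fromRel _ from rfl)]
  have hdiag : ∀ {b : ℕ} (i : Fin b) (j : Fin r) (φ : Fin b → Fin r → ℝ)
      [∀ i' j', Decidable (i = i' ∧ (j' : Fin r).val = j.val + 1)],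
      (∑ i', ∑ j', if i = i' ∧ j'.val = j.val + 1 then φ i' j' else 0) =
        ∑ j', if j'.val = j.val + 1 then φ i j' else 0 := by
    intro b i j φ _
    rw [Finset.sum_eq_single i (fun i' _ hi => by simp [hi.symm]) (by simp)]
    simp
  have h1 : ∀ u v, crabRel b₁ b₂ r (Sum.inr u) (Sum.inl v) = False := by simp [crabRel]
  have h2 : ∀ p v, crabRel b₁ b₂ r (Sum.inl (some p)) (Sum.inr v) = False := by simp [crabRel]
  have h3 : ∀ p, crabRel b₁ b₂ r (Sum.inl none) (Sum.inr (some p)) = False := by simp [crabRel]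
  have h4 : crabRel b₁ b₂ r (Sum.inl none) (Sum.inr none) = True := by simp [crabRel]
  have h5 : ∀ u, crabRel b₁ b₂ r (Sum.inl u) (Sum.inl none) = False := by
    rintro (_ | _) <;> simp [crabRel]
  have h6 : ∀ u, crabRel b₁ b₂ r (Sum.inr u) (Sum.inr none) = False := by
    rintro (_ | _) <;> simp [crabRel]
  have h7 : ∀ i j, crabRel b₁ b₂ r (Sum.inl none) (Sum.inl (some (i, j))) = (j.val = 0) := by
    simp [crabRel]
  have h8 : ∀ i j, crabRel b₁ b₂ r (Sum.inr none) (Sum.inr (some (i, j))) = (j.val = 0) := by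
    simp [crabRel]
  have h9 : ∀ i j i' j', crabRel b₁ b₂ r (Sum.inl (some (i, j))) (Sum.inl (some (i', j'))) =
      (i = i' ∧ j'.val = j.val + 1) := by simp [crabRel]
  have h10 : ∀ i j i' j', crabRel b₁ b₂ r (Sum.inr (some (i, j))) (Sum.inr (some (i', j'))) =
      (i = i' ∧ j'.val = j.val + 1) := by simp [crabRel]
  simp only [Fintype.sum_sum_type, Fintype.sum_option, Fintype.sum_prod_type, h1, h2, h3, h4, h5,
    h6, h7, h8, h9, h10, hdiag, crabLeg, ← legExt_energy, if_true, if_false, Finset.sum_const_zero,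
    Finset.sum_add_distrib]
  ring

/-- The solution `Q` (first component) of the eigenvalue equation `lam` on a path, starting with
value `1` at a free end, together with the accumulated flux `lam * ∑ m < n, Q m`. -/
def legSol (lam : ℝ) : ℕ → ℝ × ℝ
  | 0 => (1, 0)
  | n + 1 => ((legSol lam n).1 - ((legSol lam n).2 + lam * (legSol lam n).1),
      (legSol lam n).2 + lam * (legSol lam n).1)

theorem legSol_fst_succ (lam : ℝ) (n : ℕ) :
    (legSol lam (n + 1)).1 = (legSol lam n).1 - (legSol lam (n + 1)).2 := rfl

theorem legSol_snd_succ (lam : ℝ) (n : ℕ) :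
    (legSol lam (n + 1)).2 = (legSol lam n).2 + lam * (legSol lam n).1 := rfl

theorem legSol_snd_eq_sum (lam : ℝ) (n : ℕ) :
    (legSol lam n).2 = lam * ∑ k ∈ Finset.range n, (legSol lam k).1 := by
  induction n with
  | zero => simp [legSol]
  | succ n ih => rw [legSol_snd_succ, ih, Finset.sum_range_succ]; ring

theorem legSol_ne_zero (lam : ℝ) (n : ℕ) (h : (legSol lam n).1 = 0) : (legSol lam n).2 ≠ 0 := by
  induction n with
  | zero => simp [legSol] at h
  | succ n ih =>
    intro h2
    rw [legSol_fst_succ, h2, sub_zero] at h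
    rw [legSol_snd_succ, h, mul_zero, add_zero] at h2
    exact ih h h2

theorem legSol_green (lam : ℝ) (G : ℕ → ℝ) (n : ℕ) :
    ∑ k ∈ Finset.range n, ((legSol lam k).1 - (legSol lam (k + 1)).1) * (G k - G (k + 1)) =
      lam * ∑ k ∈ Finset.range n, (legSol lam k).1 * G k - G n * (legSol lam n).2 := by
  induction n with
  | zero => simp [legSol]
  | succ n ih =>
    rw [Finset.sum_range_succ, ih, Finset.sum_range_succ, legSol_fst_succ, legSol_snd_succ]
    ring

/-- The function on a crab graph with prescribed center values and legs. -/
def crabMk {b₁ b₂ : ℕ} (r : ℕ) (x y : ℝ) (w : Fin b₁ ⊕ Fin b₂ → ℕ → ℝ) : CrabV b₁ b₂ r → ℝ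
  | Sum.inl none => x
  | Sum.inr none => y
  | Sum.inl (some (i, j)) => w (Sum.inl i) j.rev
  | Sum.inr (some (i, j)) => w (Sum.inr i) j.rev

theorem crabLeg_mk {b₁ b₂ r : ℕ} (x y : ℝ) (w : Fin b₁ ⊕ Fin b₂ → ℕ → ℝ)
    (hx : ∀ i, w (Sum.inl i) r = x) (hy : ∀ i, w (Sum.inr i) r = y) (s : Fin b₁ ⊕ Fin b₂) (k : ℕ)
    (hk : k ≤ r) : crabLeg (crabMk r x y w) s k = w s k := by
  rcases hk.lt_or_eq with h | rfl
  · rcases s with i | i <;> simp [crabLeg, legExt, crabMk, h]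
  · rcases s with i | i <;> simp [crabLeg, legExt, crabMk, hx, hy]

theorem crab_dotProduct_mk {b₁ b₂ r : ℕ} (x y : ℝ) (w : Fin b₁ ⊕ Fin b₂ → ℕ → ℝ)
    (hx : ∀ i, w (Sum.inl i) r = x) (hy : ∀ i, w (Sum.inr i) r = y) (f : CrabV b₁ b₂ r → ℝ) :
    crabMk r x y w ⬝ᵥ f = x * f (Sum.inl none) + y * f (Sum.inr none) +
      ∑ s, ∑ k ∈ Finset.range r, w s k * crabLeg f s k := by
  rw [crab_dotProduct]
  congr 1
  refine Finset.sum_congr rfl fun s _ => Finset.sum_congr rfl fun k hk => ?_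
  rw [crabLeg_mk x y w hx hy s k (Finset.mem_range.1 hk).le]

theorem crab_energy_mk {b₁ b₂ r : ℕ} [DecidableEq (CrabV b₁ b₂ r)]
    [DecidableRel (crab b₁ b₂ r).Adj] (x y : ℝ) (w : Fin b₁ ⊕ Fin b₂ → ℕ → ℝ)
    (hx : ∀ i, w (Sum.inl i) r = x) (hy : ∀ i, w (Sum.inr i) r = y) (f : CrabV b₁ b₂ r → ℝ) :
    crabMk r x y w ⬝ᵥ Matrix.mulVec ((crab b₁ b₂ r).lapMatrix ℝ) f =
      (x - y) * (f (Sum.inl none) - f (Sum.inr none)) +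
      ∑ s, ∑ k ∈ Finset.range r, (w s k - w s (k + 1)) * (crabLeg f s k - crabLeg f s (k + 1)) := by
  rw [crab_energy]
  congr 1
  refine Finset.sum_congr rfl fun s _ => Finset.sum_congr rfl fun k hk => ?_
  have := Finset.mem_range.1 hk
  rw [crabLeg_mk x y w hx hy s k this.le, crabLeg_mk x y w hx hy s (k + 1) this]

/-- A test space of functions that are multiples of one profile on either half of the crab. -/
theorem lapEig_crab_two_lt {b₁ b₂ r : ℕ} (lam : ℝ) (v : ℕ → ℝ)
    (h : ∀ α β : ℝ, (α, β) ≠ 0 →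
      (α ^ 2 * b₁ + β ^ 2 * b₂) * (∑ k ∈ Finset.range r, (v k - v (k + 1)) ^ 2 -
        lam * ∑ k ∈ Finset.range r, v k ^ 2) +
      ((α - β) ^ 2 - lam * (α ^ 2 + β ^ 2)) * v r ^ 2 < 0) :
    lapEig (crab b₁ b₂ r) 2 < lam := by
  have hcard : 2 ≤ Fintype.card (CrabV b₁ b₂ r) := by simp; omega
  obtain ⟨e₀, -, -, -, -, -, -, -, -, -, hmin⟩ := lapEig_two_spec (crab b₁ b₂ r) hcard
  let W : ℝ → ℝ → Fin b₁ ⊕ Fin b₂ → ℕ → ℝ :=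
    fun α β s k => Sum.elim (fun _ => α * v k) (fun _ => β * v k) s
  let g : ℝ → ℝ → CrabV b₁ b₂ r → ℝ := fun α β => crabMk r (α * v r) (β * v r) (W α β)
  have hlin : ∃ p q : ℝ, ∀ α β, g α β ⬝ᵥ e₀ = α * p + β * q := by
    refine ⟨g 1 0 ⬝ᵥ e₀, g 0 1 ⬝ᵥ e₀, fun α β => ?_⟩
    rw [← smul_eq_mul, ← smul_eq_mul, ← smul_dotProduct, ← smul_dotProduct, ← add_dotProduct]
    congr 1
    ext x
    rcases x with ((_ | ⟨_, _⟩) | (_ | ⟨_, _⟩)) <;> simp [g, W, crabMk]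
  obtain ⟨p, q, hpq⟩ := hlin
  obtain ⟨α, β, hne, h0⟩ : ∃ α β : ℝ, (α, β) ≠ 0 ∧ g α β ⬝ᵥ e₀ = 0 := by
    by_cases hq : q = 0
    · by_cases hp : p = 0
      · exact ⟨1, 0, by simp, by simp [hpq, hp]⟩
      · exact ⟨0, 1, by simp, by simp [hpq, hq]⟩
    · exact ⟨q, -p, by simp [hq], by rw [hpq]; ring⟩
  have hleg : ∀ s k, k ≤ r → crabLeg (g α β) s k = W α β s k :=
    crabLeg_mk _ _ _ (fun _ => rfl) (fun _ => rfl)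
  have hE : g α β ⬝ᵥ Matrix.mulVec ((crab b₁ b₂ r).lapMatrix ℝ) (g α β) =
      (α - β) ^ 2 * v r ^ 2 +
        (α ^ 2 * b₁ + β ^ 2 * b₂) * ∑ k ∈ Finset.range r, (v k - v (k + 1)) ^ 2 := by
    rw [crab_energy]
    have : ∀ s, ∑ k ∈ Finset.range r, (crabLeg (g α β) s k - crabLeg (g α β) s (k + 1)) *
        (crabLeg (g α β) s k - crabLeg (g α β) s (k + 1)) =
        Sum.elim (fun _ => α ^ 2) (fun _ => β ^ 2) s *
          ∑ k ∈ Finset.range r, (v k - v (k + 1)) ^ 2 := by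
      intro s
      rw [Finset.mul_sum]
      refine Finset.sum_congr rfl fun k hk => ?_
      have := Finset.mem_range.1 hk
      rw [hleg s k this.le, hleg s (k + 1) this]
      rcases s with i | i <;> simp only [W, Sum.elim_inl, Sum.elim_inr] <;> ring
    simp only [this, g, crabMk]
    simp
    ring
  have hN : g α β ⬝ᵥ g α β = (α ^ 2 + β ^ 2) * v r ^ 2 +
        (α ^ 2 * b₁ + β ^ 2 * b₂) * ∑ k ∈ Finset.range r, v k ^ 2 := by
    rw [crab_dotProduct]
    have : ∀ s, ∑ k ∈ Finset.range r, crabLeg (g α β) s k * crabLeg (g α β) s k =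
        Sum.elim (fun _ => α ^ 2) (fun _ => β ^ 2) s *
          ∑ k ∈ Finset.range r, v k ^ 2 := by
      intro s
      rw [Finset.mul_sum]
      refine Finset.sum_congr rfl fun k hk => ?_
      rw [hleg s k (Finset.mem_range.1 hk).le]
      rcases s with i | i <;> simp only [W, Sum.elim_inl, Sum.elim_inr] <;> ring
    simp only [this, g, crabMk]
    simp
    ring
  have h1 := hmin _ h0
  have h2 := h α β hne
  have h3 : 0 ≤ g α β ⬝ᵥ g α β := by
    simpa using dotProduct_star_self_nonneg (g α β)
  have h4 : lapEig (crab b₁ b₂ r) 2 * (g α β ⬝ᵥ g α β) < lam * (g α β ⬝ᵥ g α β) := by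
    refine h1.trans_lt ?_
    rw [hE, hN]
    linarith
  exact lt_of_mul_lt_mul_right h4 h3

theorem crabLeg_r {b₁ b₂ r : ℕ} (f : CrabV b₁ b₂ r → ℝ) (s : Fin b₁ ⊕ Fin b₂) :
    crabLeg f s r = Sum.elim (fun _ => f (Sum.inl none)) (fun _ => f (Sum.inr none)) s := by
  rcases s with i | i <;> simp [crabLeg, legExt_self]

section Eigenfunction

variable {b₁ b₂ r : ℕ} [DecidableEq (CrabV b₁ b₂ r)] [DecidableRel (crab b₁ b₂ r).Adj]
  {lam : ℝ} {f : CrabV b₁ b₂ r → ℝ}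

theorem crabLeg_of_eigen
    (hf : Matrix.mulVec ((crab b₁ b₂ r).lapMatrix ℝ) f = lam • f) (s : Fin b₁ ⊕ Fin b₂) (k : ℕ)
    (hk : k ≤ r) : crabLeg f s k = crabLeg f s 0 * (legSol lam k).1 := by
  have hflux : ∀ m < r, crabLeg f s (m + 1) =
      crabLeg f s m - lam * ∑ k ∈ Finset.range (m + 1), crabLeg f s k := by
    intro m hm
    let w : Fin b₁ ⊕ Fin b₂ → ℕ → ℝ := fun t k => if t = s ∧ k < m + 1 then 1 else 0
    have hw : ∀ t, w t r = 0 := fun t => if_neg fun h => by omega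
    have h1 := crab_energy_mk 0 0 w (fun i => hw _) (fun i => hw _) f
    rw [hf, dotProduct_smul, crab_dotProduct_mk 0 0 w (fun i => hw _) (fun i => hw _) f,
      Finset.sum_eq_single s (fun t _ ht => by simp [w, ht]) (by simp),
      Finset.sum_eq_single s (fun t _ ht => by simp [w, ht]) (by simp),
      Finset.sum_eq_single (s := Finset.range r)
        (f := fun k => (w s k - w s (k + 1)) * (crabLeg f s k - crabLeg f s (k + 1))) m] at h1
    · have h2 : ∑ k ∈ Finset.range r, w s k * crabLeg f s k =
          ∑ k ∈ Finset.range (m + 1), crabLeg f s k := by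
        simp only [w, true_and, ite_mul, one_mul, zero_mul]
        rw [← Finset.sum_filter]
        refine Finset.sum_congr ?_ fun _ _ => rfl
        ext k
        simp only [Finset.mem_filter, Finset.mem_range]
        omega
      rw [h2] at h1
      simp [w] at h1
      linarith
    · intro k _ hkm
      have : k < m + 1 ↔ k + 1 < m + 1 := by omega
      have hw' : w s k = w s (k + 1) := by simp only [w, this]
      rw [hw', sub_self, zero_mul]
    · simp [hm]
  have key : ∀ k ≤ r, crabLeg f s k = crabLeg f s 0 * (legSol lam k).1 ∧
      lam * ∑ j ∈ Finset.range k, crabLeg f s j = crabLeg f s 0 * (legSol lam k).2 := by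
    intro k
    induction k with
    | zero => simp [legSol]
    | succ k ih =>
      intro hk
      obtain ⟨h1, h2⟩ := ih (by omega)
      have h3 : lam * ∑ j ∈ Finset.range (k + 1), crabLeg f s j =
          crabLeg f s 0 * (legSol lam (k + 1)).2 := by
        rw [Finset.sum_range_succ, mul_add, h2, h1, legSol_snd_succ]; ring
      exact ⟨by rw [hflux k (by omega), h3, h1, legSol_fst_succ]; ring, h3⟩
  exact (key k hk).1

theorem eq_zero_of_center_eq_zero (hf : Matrix.mulVec ((crab b₁ b₂ r).lapMatrix ℝ) f = lam • f)
    (hc : (legSol lam r).1 ≠ 0) (hl : f (Sum.inl none) = 0) (hr : f (Sum.inr none) = 0) :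
    f = 0 := by
  rw [← dotProduct_self_eq_zero, crab_dotProduct, hl, hr]
  have h0 : ∀ s, crabLeg f s 0 = 0 := by
    intro s
    have h1 := crabLeg_of_eigen hf s r le_rfl
    have h2 : crabLeg f s r = 0 := by rw [crabLeg_r]; rcases s with i | i <;> simp [hl, hr]
    rw [h2] at h1
    simpa [hc] using h1.symm
  have : ∀ s, ∑ k ∈ Finset.range r, crabLeg f s k * crabLeg f s k = 0 := fun s =>
    Finset.sum_eq_zero fun k hk => by
      rw [crabLeg_of_eigen hf s k (Finset.mem_range.1 hk).le, h0]; simp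
  simp [this]

theorem center_equations (hf : Matrix.mulVec ((crab b₁ b₂ r).lapMatrix ℝ) f = lam • f) :
    (b₁ * (legSol lam r).2 + (lam - 1) * (legSol lam r).1) * f (Sum.inl none) +
        (legSol lam r).1 * f (Sum.inr none) = 0 ∧
      (b₂ * (legSol lam r).2 + (lam - 1) * (legSol lam r).1) * f (Sum.inr none) +
        (legSol lam r).1 * f (Sum.inl none) = 0 := by
  have h := fun α β : ℝ => crab_energy_mk (α * (legSol lam r).1) (β * (legSol lam r).1)
    (fun s k => Sum.elim (fun _ : Fin b₁ => α) (fun _ : Fin b₂ => β) s * (legSol lam k).1)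
    (fun _ => rfl) (fun _ => rfl) f
  have h' := fun α β : ℝ => crab_dotProduct_mk (α * (legSol lam r).1) (β * (legSol lam r).1)
    (fun s k => Sum.elim (fun _ : Fin b₁ => α) (fun _ : Fin b₂ => β) s * (legSol lam k).1)
    (fun _ => rfl) (fun _ => rfl) f
  simp only [hf, dotProduct_smul, h', ← mul_sub, mul_assoc, ← Finset.mul_sum, legSol_green,
    crabLeg_r, Fintype.sum_sum_type, Sum.elim_inl, Sum.elim_inr, Finset.sum_sub_distrib,
    Finset.sum_const, Finset.card_univ, Fintype.card_fin, smul_eq_mul, nsmul_eq_mul] at h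
  have h10 := h 1 0
  have h01 := h 0 1
  simp only [one_mul, zero_mul] at h10 h01
  constructor <;> linarith

end Eigenfunction

theorem lapEig_crab_two_pos {b₁ b₂ r : ℕ} : 0 < lapEig (crab b₁ b₂ r) 2 := by
  have hcard : 2 ≤ Fintype.card (CrabV b₁ b₂ r) := by simp; omega
  obtain ⟨e₀, e₁, μ, h00, h11, h01, he₀, he₁, hμ, hle, -⟩ := lapEig_two_spec (crab b₁ b₂ r) hcard
  by_contra hneg
  have hlam : lapEig (crab b₁ b₂ r) 2 = 0 := by linarith
  have hμ0 : μ = 0 := by linarith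
  rw [hlam] at he₁
  rw [hμ0] at he₀
  have hsol : ∀ n, legSol 0 n = (1, 0) := by
    intro n
    induction n with
    | zero => rfl
    | succ n ih => simp [legSol, ih]
  have c₀ := (center_equations he₀).1
  have c₁ := (center_equations he₁).1
  simp only [hsol, mul_zero, zero_sub, zero_add, mul_one, one_mul] at c₀ c₁
  set x₀ := e₀ (Sum.inl none) with hx₀
  set x₁ := e₁ (Sum.inl none) with hx₁
  have hz : x₁ • e₀ - x₀ • e₁ = 0 := by
    refine eq_zero_of_center_eq_zero (lam := 0) ?_ (by simp [hsol]) ?_ ?_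
    · rw [Matrix.mulVec_sub, Matrix.mulVec_smul, Matrix.mulVec_smul, he₀, he₁]; simp
    · simp [← hx₀, ← hx₁, mul_comm]
    · simp only [Pi.sub_apply, Pi.smul_apply, smul_eq_mul]
      linear_combination x₁ * c₀ - x₀ * c₁
  have h0 : x₁ = 0 := by
    simpa [h00, h01, dotProduct_comm e₁ e₀] using congrArg (· ⬝ᵥ e₀) hz
  have : e₁ = 0 := by
    refine eq_zero_of_center_eq_zero he₁ (by simp [hsol]) h0 ?_
    rw [h0] at c₁; linarith
  simp [this] at h11

theorem lapEig_crab_two_lt_of_legSol_nonpos {b₁ b₂ r : ℕ} {lam : ℝ} (hlam : 0 < lam) (hr : 1 ≤ r)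
    (hb₁ : 1 ≤ b₁) (hb₂ : 1 ≤ b₂) (h : (legSol lam r).1 * (legSol lam r).2 ≤ 0) :
    lapEig (crab b₁ b₂ r) 2 < lam := by
  have hb₁' : (1 : ℝ) ≤ b₁ := by exact_mod_cast hb₁
  have hb₂' : (1 : ℝ) ≤ b₂ := by exact_mod_cast hb₂
  have hpos : ∀ α β : ℝ, (α, β) ≠ 0 → 0 < α ^ 2 + β ^ 2 := by
    intro α β hne
    by_contra hcon
    have h1 : α = 0 := by nlinarith [sq_nonneg α, sq_nonneg β]
    have h2 : β = 0 := by nlinarith [sq_nonneg α, sq_nonneg β]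
    exact hne (by simp [h1, h2])
  have hQ := legSol_green lam (fun k => (legSol lam k).1) r
  by_cases hc : (legSol lam r).1 = 0
  · have he := legSol_ne_zero lam r hc
    obtain ⟨n, rfl⟩ : ∃ n, r = n + 1 := ⟨r - 1, by omega⟩
    set e := (legSol lam (n + 1)).2 with hedef
    have hn : (legSol lam n).1 = e := by
      have := legSol_fst_succ lam n
      linarith
    refine lapEig_crab_two_lt lam (fun k => if k ≤ n then (legSol lam k).1 else e / 4) ?_
    intro α β hne
    have h1 : ∑ k ∈ Finset.range (n + 1), (if k ≤ n then (legSol lam k).1 else e / 4) ^ 2 =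
        ∑ k ∈ Finset.range (n + 1), (legSol lam k).1 * (legSol lam k).1 := by
      refine Finset.sum_congr rfl fun k hk => ?_
      rw [if_pos (by have := Finset.mem_range.1 hk; omega), sq]
    have h2 : ∑ k ∈ Finset.range (n + 1), ((if k ≤ n then (legSol lam k).1 else e / 4) -
        (if k + 1 ≤ n then (legSol lam (k + 1)).1 else e / 4)) ^ 2 =
        ∑ k ∈ Finset.range (n + 1), ((legSol lam k).1 - (legSol lam (k + 1)).1) *
          ((legSol lam k).1 - (legSol lam (k + 1)).1) - 7 / 16 * e ^ 2 := by
      rw [Finset.sum_range_succ, Finset.sum_range_succ, hn, hc]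
      have : ∀ k ∈ Finset.range n, ((if k ≤ n then (legSol lam k).1 else e / 4) -
          (if k + 1 ≤ n then (legSol lam (k + 1)).1 else e / 4)) ^ 2 =
          ((legSol lam k).1 - (legSol lam (k + 1)).1) *
            ((legSol lam k).1 - (legSol lam (k + 1)).1) := by
        intro k hk
        have := Finset.mem_range.1 hk
        rw [if_pos (by omega), if_pos (by omega), sq]
      rw [Finset.sum_congr rfl this, if_pos le_rfl, if_neg (by omega)]
      ring
    rw [h1, h2, hQ, hc, if_neg (by omega)]
    have h3 := hpos α β hne
    have h4 : 0 < e ^ 2 := by positivity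
    have h5 : α ^ 2 + β ^ 2 ≤ α ^ 2 * b₁ + β ^ 2 * b₂ := by
      nlinarith [sq_nonneg α, sq_nonneg β]
    have h6 := mul_le_mul_of_nonneg_right h5 h4.le
    have h7 := mul_pos h3 h4
    have h8 := mul_nonneg (sq_nonneg (α + β)) h4.le
    have h9 := mul_pos hlam h7
    ring_nf at h6 h7 h8 h9 ⊢
    linarith
  · set c := (legSol lam r).1 with hcdef
    refine lapEig_crab_two_lt lam (fun k => (legSol lam k).1 - c) ?_
    intro α β hne
    have hG := legSol_green lam (fun k => (legSol lam k).1 - c) r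
    have hS := legSol_snd_eq_sum lam r
    have h1 : ∑ k ∈ Finset.range r, ((legSol lam k).1 - c - ((legSol lam (k + 1)).1 - c)) ^ 2 =
        lam * ∑ k ∈ Finset.range r, (legSol lam k).1 * ((legSol lam k).1 - c) := by
      rw [← hcdef, sub_self, zero_mul, sub_zero] at hG
      rw [← hG]
      refine Finset.sum_congr rfl fun k _ => ?_
      ring
    have h2 : lam * ∑ k ∈ Finset.range r, (legSol lam k).1 * ((legSol lam k).1 - c) -
        lam * ∑ k ∈ Finset.range r, ((legSol lam k).1 - c) ^ 2 =
        c * (legSol lam r).2 - lam * r * c ^ 2 := by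
      have : ∀ k, ((legSol lam k).1 - c) ^ 2 =
          (legSol lam k).1 * ((legSol lam k).1 - c) - c * (legSol lam k).1 + c ^ 2 := by
        intro k; ring
      simp only [this, Finset.sum_add_distrib, Finset.sum_sub_distrib, ← Finset.mul_sum,
        Finset.sum_const, Finset.card_range, nsmul_eq_mul]
      rw [hS]
      ring
    rw [h1, h2, ← hcdef, sub_self]
    have h3 := hpos α β hne
    have h4 : 0 < lam * r * c ^ 2 := by positivity
    have h5 : 0 < α ^ 2 * b₁ + β ^ 2 * b₂ := by
      nlinarith [sq_nonneg α, sq_nonneg β]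
    nlinarith

theorem lapEig_crab_balance {b₁ b₂ r : ℕ} (hr : 1 ≤ r) (hb₁ : 1 ≤ b₁) (h : b₁ < b₂ - 1) :
    lapEig (crab (b₁ + 1) (b₂ - 1) r) 2 < lapEig (crab b₁ b₂ r) 2 := by
  have hlam := lapEig_crab_two_pos (b₁ := b₁) (b₂ := b₂) (r := r)
  have hcard : 2 ≤ Fintype.card (CrabV b₁ b₂ r) := by simp; omega
  obtain ⟨-, f, -, -, hf1, -, -, hf, -⟩ := lapEig_two_spec (crab b₁ b₂ r) hcard
  set lam := lapEig (crab b₁ b₂ r) 2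
  rcases le_or_gt ((legSol lam r).1 * (legSol lam r).2) 0 with hce | hce
  · exact lapEig_crab_two_lt_of_legSol_nonpos hlam hr (by omega) (by omega) hce
  obtain ⟨c₁, c₂⟩ := center_equations hf
  have hQ := legSol_green lam (fun k => (legSol lam k).1) r
  have hcen := fun hc => eq_zero_of_center_eq_zero (lam := lam) hf hc
  refine lapEig_crab_two_lt lam (fun k => (legSol lam k).1) fun α β hne => ?_
  simp only [sq ((legSol lam _).1 - _), sq (legSol lam _).1, hQ]
  set c := (legSol lam r).1
  set e := (legSol lam r).2
  set x := f (Sum.inl none)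
  set y := f (Sum.inr none)
  have hc : c ≠ 0 := by rintro h; simp [h] at hce
  have hc2 : 0 < c ^ 2 := by positivity
  have hgap : (0 : ℝ) < b₂ - 1 - b₁ := by
    have : ((b₁ + 2 : ℕ) : ℝ) ≤ b₂ := by exact_mod_cast (by omega : b₁ + 2 ≤ b₂)
    push_cast at this
    linarith
  have hb₁' : (1 : ℝ) ≤ b₁ := by exact_mod_cast hb₁
  set t := c * e with ht
  set A₁ := b₁ * t + (lam - 1) * c ^ 2 with hA₁
  set A₂ := b₂ * t + (lam - 1) * c ^ 2 with hA₂
  have d₁ : A₁ * x + c ^ 2 * y = 0 := by rw [hA₁, ht]; linear_combination c * c₁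
  have d₂ : A₂ * y + c ^ 2 * x = 0 := by rw [hA₂, ht]; linear_combination c * c₂
  have hx : x ≠ 0 := by
    intro hx
    have hy : y = 0 := by rw [hx] at d₁; simpa [hc] using d₁
    have := hcen hc hx hy
    simp [this] at hf1
  have hprod : A₁ * A₂ = (c ^ 2) ^ 2 := by
    refine mul_right_cancel₀ hx ?_
    linear_combination A₂ * d₁ - c ^ 2 * d₂
  have hs₁ : 0 < A₁ + c ^ 2 := by
    have : A₁ + c ^ 2 = b₁ * t + lam * c ^ 2 := by rw [hA₁]; ring
    rw [this]; positivity
  have hs₂ : 0 < A₂ + c ^ 2 := by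
    have : A₂ + c ^ 2 = b₂ * t + lam * c ^ 2 := by rw [hA₂]; ring
    rw [this]; positivity
  have hA₁pos : 0 < A₁ := by
    by_contra hcon
    have hA₂neg : A₂ ≤ 0 := by
      by_contra h2
      nlinarith
    nlinarith
  have hdiff : A₂ - A₁ - t = t * (b₂ - 1 - b₁) := by rw [hA₁, hA₂]; ring
  have hprod' : (c ^ 2) ^ 2 < (A₁ + t) * (A₂ - t) := by
    have : (A₁ + t) * (A₂ - t) = A₁ * A₂ + t * (A₂ - A₁ - t) := by ring
    rw [this, hdiff, hprod]
    have := mul_pos hce (mul_pos hce hgap)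
    linarith
  have hB₁ : 0 < A₁ + t := by linarith
  have hform : 0 < (A₁ + t) * α ^ 2 + 2 * c ^ 2 * α * β + (A₂ - t) * β ^ 2 := by
    refine (mul_pos_iff_of_pos_left hB₁).1 ?_
    have hsq : (A₁ + t) * ((A₁ + t) * α ^ 2 + 2 * c ^ 2 * α * β + (A₂ - t) * β ^ 2) =
        ((A₁ + t) * α + c ^ 2 * β) ^ 2 + ((A₁ + t) * (A₂ - t) - (c ^ 2) ^ 2) * β ^ 2 := by ring
    rw [hsq]
    by_cases hβ : β = 0
    · have hα : α ≠ 0 := by rintro rfl; simp [hβ] at hne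
      rw [hβ]
      simp only [mul_zero, add_zero, ne_eq, OfNat.ofNat_ne_zero, not_false_eq_true, zero_pow]
      positivity
    · have := mul_pos (sub_pos.2 hprod') (by positivity : 0 < β ^ 2)
      positivity
  have hcast : ((b₂ - 1 : ℕ) : ℝ) = b₂ - 1 := by push_cast [show 1 ≤ b₂ by omega]; ring
  rw [hcast]
  push_cast
  have hfinal : ((A₁ + t) * α ^ 2 + 2 * c ^ 2 * α * β + (A₂ - t) * β ^ 2) =
      -((α ^ 2 * (b₁ + 1) + β ^ 2 * (b₂ - 1)) * -(c * e) +
        ((α - β) ^ 2 - lam * (α ^ 2 + β ^ 2)) * c ^ 2) := by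
    rw [hA₁, hA₂, ht]; ring
  linarith

theorem lapEig_crab_lt_one {b r : ℕ} (hr : 1 ≤ r) (k : ℕ) (hk : 1 ≤ k) (hkb : 2 * (k + 1) ≤ b) :
    lapEig (crab (k + 1) (b - (k + 1)) r) 2 < lapEig (crab 1 (b - 1) r) 2 := by
  induction k, hk using Nat.le_induction with
  | base =>
    rw [show b - (1 + 1) = b - 1 - 1 by omega]
    exact lapEig_crab_balance (b₁ := 1) hr le_rfl (by omega)
  | succ k hk ih =>
    refine lt_trans ?_ (ih (by omega))
    rw [show b - (k + 1 + 1) = b - (k + 1) - 1 by omega]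
    exact lapEig_crab_balance hr (by omega) (by omega)

/-- **Lemma (strict balancing of crab graphs).**
For `r ≥ 1` and `1 ≤ b₁ < b₂ − 1`, `λ₂(CG_{b₁+1,b₂−1;r}) < λ₂(CG_{b₁,b₂;r})`.
Consequently for `1 ≤ b₁ < b`, `λ₂(CG_{b₁,b−b₁;r}) ≤ λ₂(CG_{1,b−1;r})`, with equality
iff `b₁ = 1` or `b₁ = b − 1`. -/
theorem algebraic_connectivity_crab_balance (r : ℕ) (hr : 1 ≤ r) :
    (∀ b₁ b₂ : ℕ, 1 ≤ b₁ → b₁ < b₂ - 1 →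
      lapEig (crab (b₁ + 1) (b₂ - 1) r) 2 < lapEig (crab b₁ b₂ r) 2) ∧
    (∀ b b₁ : ℕ, 1 ≤ b₁ → b₁ < b →
      lapEig (crab b₁ (b - b₁) r) 2 ≤ lapEig (crab 1 (b - 1) r) 2 ∧
      (lapEig (crab b₁ (b - b₁) r) 2 = lapEig (crab 1 (b - 1) r) 2 ↔
        b₁ = 1 ∨ b₁ = b - 1)) := by
  have hlt : ∀ b b₁ : ℕ, 2 ≤ b₁ → 2 * b₁ ≤ b →
      lapEig (crab b₁ (b - b₁) r) 2 < lapEig (crab 1 (b - 1) r) 2 := by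
    intro b b₁ h2 hb
    obtain ⟨k, rfl⟩ : ∃ k, b₁ = k + 1 := ⟨b₁ - 1, by omega⟩
    exact lapEig_crab_lt_one hr k (by omega) hb
  refine ⟨fun b₁ b₂ h1 h2 => lapEig_crab_balance hr h1 h2, fun b b₁ h1 hb => ?_⟩
  by_cases hends : b₁ = 1 ∨ b₁ = b - 1
  · have heq : lapEig (crab b₁ (b - b₁) r) 2 = lapEig (crab 1 (b - 1) r) 2 := by
      rcases hends with rfl | h
      · rfl
      · rw [crab_lapEig_comm, h, show b - (b - 1) = 1 by omega]
    exact ⟨heq.le, iff_of_true heq hends⟩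
  · have hstrict : lapEig (crab b₁ (b - b₁) r) 2 < lapEig (crab 1 (b - 1) r) 2 := by
      rcases le_total (2 * b₁) b with h | h
      · exact hlt b b₁ (by omega) h
      · have := hlt b (b - b₁) (by omega) (by omega)
        rwa [show b - (b - b₁) = b₁ by omega, crab_lapEig_comm] at this
    exact ⟨hstrict.le, iff_of_false hstrict.ne hends⟩


end
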